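/- arXiv:2112.10818 — 2 statements merged into one kernel-verified Lean document; each statement's English description precedes it below -/
import Mathlib

section
/- Let d ∈ (0, +∞]. Then each of the functions y_0, …, y_r is nonvanishing and of constant sign on the interval (0, d) (i.e., for each j ∈ {0,…,r}, either y_j(x) > 0 for all x ∈ (0,d) or y_j(x) < 0 for all x ∈ (0,d)) if and only if d ≤ 1/e_r. -/
open Real Filter Set Asymptotics

/-- `iterExp r` is `e_r`: `e_0 = 0`, `e_{k+1} = exp (e_k)`. -/
noncomputable def iterExp : ℕ → ℝ
  | 0 => 0
  | k + 1 => Real.exp (iterExp k)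

/-- `logScale j` is `y_j`: `y_0 x = x`, `y_{j+1} x = log |y_j x|`. -/
noncomputable def logScale : ℕ → ℝ → ℝ
  | 0, x => x
  | j + 1, x => Real.log |logScale j x|

/-- The interval `(0, 1/e_r)`, where `1/e_0 = +∞`. -/
noncomputable def scaleDomain (r : ℕ) : Set ℝ :=
  if r = 0 then Set.Ioi 0 else Set.Ioo 0 (iterExp r)⁻¹

/-- `|𝒴(x)|^{⊗ q} = ∏_{j=0}^r |y_j x| ^ (q j)` (real powers). -/
noncomputable def scaleProd (r : ℕ) (q : Fin (r + 1) → ℚ) (x : ℝ) : ℝ :=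
  ∏ j : Fin (r + 1), |logScale j x| ^ (q j : ℝ)
open scoped ENNReal

/-- The extended-real bound `1/e_r` (with `1/e_0 = +∞`). -/
noncomputable def scaleBound (r : ℕ) : ℝ≥0∞ :=
  if r = 0 then ⊤ else ENNReal.ofReal (iterExp r)⁻¹

theorem iterExp_nonneg' (k : ℕ) : 0 ≤ iterExp k := by
  cases k with
  | zero => simp [iterExp]
  | succ k => simp only [iterExp]; positivity

theorem iterExp_mono' : Monotone iterExp := by
  apply monotone_nat_of_le_succ
  intro k
  have := Real.add_one_le_exp (iterExp k)
  simp only [iterExp]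
  linarith

theorem logScale_gt' (j : ℕ) : ∀ (i : ℕ) (t : ℝ), iterExp (i + j + 1) < t →
    iterExp i < logScale (j + 2) (Real.exp (-t)) := by
  induction j with
  | zero =>
    intro i t ht
    have h0 : 0 < t := lt_of_le_of_lt (iterExp_nonneg' _) ht
    simp only [logScale, abs_of_pos (Real.exp_pos _), Real.log_exp, abs_neg, abs_of_pos h0]
    rw [Real.lt_log_iff_exp_lt h0]
    exact ht
  | succ j ih =>
    intro i t ht
    have h := ih (i + 1) t (by rwa [show i + 1 + j + 1 = i + (j + 1) + 1 by ring])
    have h0 : 0 < logScale (j + 2) (Real.exp (-t)) := lt_of_le_of_lt (iterExp_nonneg' _) h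
    rw [show j + 1 + 2 = (j + 2) + 1 by ring, logScale, abs_of_pos h0,
      Real.lt_log_iff_exp_lt h0]
    exact h

theorem logScale_eq' (j : ℕ) : ∀ (i : ℕ),
    logScale (j + 2) (Real.exp (-iterExp (i + j + 1))) = iterExp i := by
  induction j with
  | zero =>
    intro i
    simp only [logScale, abs_of_pos (Real.exp_pos _), Real.log_exp, abs_neg, iterExp]
  | succ j ih =>
    intro i
    have h := ih (i + 1)
    rw [show i + 1 + j + 1 = i + (j + 1) + 1 by ring] at h
    rw [show j + 1 + 2 = (j + 2) + 1 by ring, logScale, h, abs_of_nonneg (iterExp_nonneg' _),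
      iterExp, Real.log_exp]

theorem logScale_zero' (k : ℕ) : logScale (k + 1) (iterExp (k + 1))⁻¹ = 0 := by
  rw [iterExp, ← Real.exp_neg]
  cases k with
  | zero => simp [logScale, iterExp]
  | succ j =>
    have h := logScale_eq' j 0
    rwa [zero_add] at h

theorem statement2 (r : ℕ) (d : ℝ≥0∞) (hd : 0 < d) :
    (∀ j ≤ r,
      (∀ x : ℝ, 0 < x → ENNReal.ofReal x < d → 0 < logScale j x) ∨
      (∀ x : ℝ, 0 < x → ENNReal.ofReal x < d → logScale j x < 0)) ↔
    d ≤ scaleBound r := by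
  constructor
  · intro h
    unfold scaleBound
    split_ifs with hr
    · exact le_top
    · obtain ⟨k, rfl⟩ := Nat.exists_eq_succ_of_ne_zero hr
      by_contra hlt
      rw [not_le] at hlt
      have hp : 0 < (iterExp (k + 1))⁻¹ := by
        simp only [iterExp]; positivity
      have hz := logScale_zero' k
      rcases h (k + 1) le_rfl with h | h
      · have := h _ hp hlt
        linarith
      · have := h _ hp hlt
        linarith
  · intro h j hj
    rcases j with _ | k
    · left
      intro x hx _
      exact hx
    have key : ∀ x : ℝ, 0 < x → ENNReal.ofReal x < d → iterExp k < -Real.log x := by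
      intro x hx hxd
      have h1 := lt_of_lt_of_le hxd h
      unfold scaleBound at h1
      rw [if_neg (by omega)] at h1
      have h2 := (ENNReal.ofReal_lt_ofReal_iff_of_nonneg hx.le).1 h1
      have h3 : (iterExp r)⁻¹ ≤ (iterExp (k + 1))⁻¹ :=
        inv_anti₀ (by simp only [iterExp]; positivity) (iterExp_mono' hj)
      have h4 : x < Real.exp (-iterExp k) := by
        rw [Real.exp_neg]
        exact lt_of_lt_of_le h2 h3
      have := (Real.log_lt_iff_lt_exp hx).2 h4
      linarith
    rcases k with _ | j
    · right
      intro x hx hxd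
      have := key x hx hxd
      simp only [iterExp] at this
      simp only [logScale, abs_of_pos hx]
      linarith
    · left
      intro x hx hxd
      have h5 := logScale_gt' j 0 (-Real.log x) (by rw [zero_add]; exact key x hx hxd)
      rw [neg_neg, Real.exp_log hx] at h5
      exact h5
end

section
/- Let Λ ⊆ ℚ^{r+1} \ (ℕ₀ × {0}^r) be finite and nonempty, let e_λ ∈ ℝ \ {0} for each λ ∈ Λ, let 0 < η ≤ 1/e_r, and define h : (0,η) → ℝ by h(x) = Σ_{λ∈Λ} e_λ · |𝒴(x)|^{⊗λ}. Let μ = (μ_0,…,μ_r) ∈ Λ be such that |𝒴(x)|^{⊗λ} = o(|𝒴(x)|^{⊗μ}) as x ↘ 0 for every λ ∈ Λ with λ ≠ μ. Let M ∈ ℕ and suppose there is a function ĥ defined on an open interval around 0 that is C^M at 0 and agrees with h on (0,δ) for some δ > 0. Then μ_0 ≥ M. -/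
open Real Filter Set Asymptotics

/-- Logarithm of `scaleProd`. -/
noncomputable def logProd (r : ℕ) (q : Fin (r + 1) → ℚ) (x : ℝ) : ℝ :=
  ∑ j : Fin (r + 1), (q j : ℝ) * logScale (j + 1) x

lemma logScale_tendsto (j : ℕ) :
    Tendsto (fun x => |logScale (j + 1) x|) (nhdsWithin 0 (Set.Ioi 0)) atTop := by
  induction j with
  | zero =>
    have h : Tendsto Real.log (nhdsWithin 0 (Set.Ioi 0)) atBot :=
      Real.tendsto_log_nhdsNE_zero.mono_left <| nhdsWithin_mono _ fun _ h ↦ ne_of_gt h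
    have := tendsto_abs_atBot_atTop.comp h
    simpa [logScale, Function.comp_def] using this
  | succ n ih =>
    exact tendsto_abs_atTop_atTop.comp (Real.tendsto_log_atTop.comp ih)

lemma logScale_isLittleO_succ (j : ℕ) :
    (fun x => logScale (j + 1 + 1) x) =o[nhdsWithin 0 (Set.Ioi 0)] logScale (j + 1) := by
  have := Real.isLittleO_log_id_atTop.comp_tendsto (logScale_tendsto j)
  exact (this.abs_right.congr_right (fun x => by simp)).of_abs_right

lemma logScale_isLittleO (i j : ℕ) (h : i < j) :
    (fun x => logScale (j + 1) x) =o[nhdsWithin 0 (Set.Ioi 0)] logScale (i + 1) := by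
  induction j, h using Nat.le_induction with
  | base => exact logScale_isLittleO_succ i
  | succ n _ ih => exact (logScale_isLittleO_succ n).trans ih

lemma eventually_ne (j : ℕ) : ∀ᶠ x in nhdsWithin (0:ℝ) (Set.Ioi 0), logScale j x ≠ 0 := by
  cases j with
  | zero =>
    filter_upwards [self_mem_nhdsWithin] with x hx
    exact ne_of_gt hx
  | succ n =>
    filter_upwards [(logScale_tendsto n).eventually_gt_atTop 0] with x hx
    exact abs_pos.1 hx

lemma scaleProd_eq (r : ℕ) (q : Fin (r + 1) → ℚ) :
    ∀ᶠ x in nhdsWithin (0:ℝ) (Set.Ioi 0), scaleProd r q x = Real.exp (logProd r q x) := by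
  have : ∀ᶠ x in nhdsWithin (0:ℝ) (Set.Ioi 0), ∀ j : Fin (r + 1), logScale j x ≠ 0 :=
    eventually_all.2 fun j => eventually_ne j
  filter_upwards [this] with x hx
  rw [logProd, Real.exp_sum, scaleProd]
  refine Finset.prod_congr rfl fun j _ => ?_
  rw [Real.rpow_def_of_pos (abs_pos.2 (hx j)), mul_comm]
  rfl

lemma logProd_ratio (r : ℕ) (q : Fin (r + 1) → ℚ) (j : Fin (r + 1)) (hq : ∀ i < j, q i = 0) :
    Tendsto (fun x => logProd r q x / logScale (j + 1) x) (nhdsWithin 0 (Set.Ioi 0))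
      (nhds (q j : ℝ)) := by
  have h : ∀ i : Fin (r + 1), Tendsto (fun x => (q i : ℝ) * (logScale (i + 1) x /
      logScale (j + 1) x)) (nhdsWithin 0 (Set.Ioi 0)) (nhds (if i = j then (q j : ℝ) else 0)) := by
    intro i
    rcases lt_trichotomy i j with h | h | h
    · simp [hq i h, h.ne]
    · subst h
      simp only [if_true]
      refine tendsto_const_nhds.congr' ?_
      filter_upwards [eventually_ne (i + 1)] with x hx
      rw [div_self hx, mul_one]
    · rw [if_neg h.ne']
      simpa using (logScale_isLittleO j i h).tendsto_div_nhds_zero.const_mul (q i : ℝ)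
  have h2 := tendsto_finsetSum (Finset.univ) (fun i _ => h i)
  simp only [Finset.sum_ite_eq', Finset.mem_univ, if_true] at h2
  refine h2.congr fun x => ?_
  rw [logProd, Finset.sum_div]
  exact Finset.sum_congr rfl fun i _ => by ring

lemma logProd_abs (r : ℕ) (q : Fin (r + 1) → ℚ) (hq : q ≠ 0) :
    Tendsto (fun x => |logProd r q x|) (nhdsWithin 0 (Set.Ioi 0)) atTop := by
  classical
  have hne : (Finset.univ.filter fun i => q i ≠ 0).Nonempty := by
    obtain ⟨i, hi⟩ := Function.ne_iff.1 hq
    exact ⟨i, by simpa using hi⟩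
  obtain ⟨j, hj, hmin⟩ := Finset.exists_min_image _ id hne
  have hj' : q j ≠ 0 := by simpa using hj
  have h := (logProd_ratio r q j (fun i hi => by
    by_contra h0
    exact absurd (hmin i (by simpa using h0)) (not_le.2 hi))).abs
  have := h.pos_mul_atTop (abs_pos.2 (by exact_mod_cast hj')) (logScale_tendsto j)
  refine this.congr' ?_
  filter_upwards [eventually_ne (j + 1)] with x hx
  rw [← abs_mul, div_mul_cancel₀ _ hx]

lemma logProd_atBot (r : ℕ) (q : Fin (r + 1) → ℚ) (hq : 0 < q 0) :
    Tendsto (fun x => logProd r q x) (nhdsWithin 0 (Set.Ioi 0)) atBot := by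
  have h := logProd_ratio r q 0 (fun i hi => absurd hi (by simp))
  have hl : Tendsto (fun x => logScale ((0 : Fin (r + 1)) + 1) x)
      (nhdsWithin 0 (Set.Ioi 0)) atBot := by
    have h : Tendsto Real.log (nhdsWithin 0 (Set.Ioi 0)) atBot :=
      Real.tendsto_log_nhdsNE_zero.mono_left <| nhdsWithin_mono _ fun _ h ↦ ne_of_gt h
    simpa [logScale] using h
  have := h.pos_mul_atBot (by exact_mod_cast hq) hl
  refine this.congr' ?_
  filter_upwards [eventually_ne ((0 : Fin (r + 1)) + 1)] with x hx
  rw [div_mul_cancel₀ _ hx]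

lemma pow_div_scaleProd (r : ℕ) (μ : Fin (r + 1) → ℚ) (k : ℕ) :
    ∀ᶠ x in nhdsWithin (0:ℝ) (Set.Ioi 0), x ^ k / scaleProd r μ x =
      Real.exp (logProd r ((Pi.single 0 (k : ℚ)) - μ) x) := by
  filter_upwards [scaleProd_eq r μ, self_mem_nhdsWithin] with x hx hx0
  have hx0 : 0 < x := hx0
  have : logProd r ((Pi.single 0 (k : ℚ)) - μ) x = k * Real.log x - logProd r μ x := by
    have h1 : (k : ℝ) * Real.log x =
        ∑ j : Fin (r + 1), ((Pi.single 0 (k : ℚ) : Fin (r + 1) → ℚ) j : ℝ) *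
          logScale (j + 1) x := by
      rw [Finset.sum_eq_single 0]
      · simp [logScale]
      · intro b _ hb
        simp [hb]
      · simp
    rw [h1, logProd, logProd, ← Finset.sum_sub_distrib]
    refine Finset.sum_congr rfl fun j _ => ?_
    rw [Pi.sub_apply]
    push_cast
    ring
  rw [this, hx, Real.exp_sub, mul_comm, Real.exp_mul, Real.exp_log hx0, Real.rpow_natCast]

lemma exists_taylor_poly (M : ℕ) (f : ℝ → ℝ) (hf : ContDiffAt ℝ (M : ℕ∞) f 0) :
    ∃ P : Polynomial ℝ, Tendsto (fun x => (f x - P.eval x) / x ^ M)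
      (nhdsWithin 0 (Set.Ioi 0)) (nhds 0) := by
  obtain ⟨u, hu, -, hfu⟩ := ContDiffWithinAt.contDiffOn (m := (M : ℕ∞)) le_rfl (by simp) hf
  simp only [Set.insert_eq_of_mem (Set.mem_univ (0:ℝ)), nhdsWithin_univ] at hu
  obtain ⟨ε, hε, hball⟩ := Metric.mem_nhds_iff.1 hu
  have h := taylor_isLittleO (convex_ball (0:ℝ) ε) (Metric.mem_ball_self hε)
    (n := M) (hfu.mono hball)
  rw [(Metric.isOpen_ball).nhdsWithin_eq (Metric.mem_ball_self hε)] at h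
  refine ⟨∑ k ∈ Finset.range (M + 1), Polynomial.C ((k.factorial : ℝ)⁻¹ *
    iteratedDerivWithin k f (Metric.ball 0 ε) 0) * Polynomial.X ^ k, ?_⟩
  have h2 := h.tendsto_div_nhds_zero.mono_left (nhdsWithin_le_nhds (s := Set.Ioi 0))
  refine h2.congr fun x => ?_
  rw [taylor_within_apply, Polynomial.eval_finsetSum]
  simp only [sub_zero]
  congr 2
  refine Finset.sum_congr rfl fun k _ => ?_
  simp only [Polynomial.eval_mul, Polynomial.eval_C, Polynomial.eval_pow, Polynomial.eval_X,
    smul_eq_mul]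
  ring

theorem statement12 (r : ℕ) (Λ : Finset (Fin (r + 1) → ℚ)) (hΛ : Λ.Nonempty)
    (hΛ' : ∀ l ∈ Λ, ¬((∃ k : ℕ, l 0 = k) ∧ ∀ i, i ≠ 0 → l i = 0))
    (e : (Fin (r + 1) → ℚ) → ℝ) (he : ∀ l ∈ Λ, e l ≠ 0)
    (η : ℝ) (hη : 0 < η) (hη' : r ≠ 0 → η ≤ (iterExp r)⁻¹)
    (μ : Fin (r + 1) → ℚ) (hμ : μ ∈ Λ)
    (hμo : ∀ l ∈ Λ, l ≠ μ →
      Filter.Tendsto (fun x => scaleProd r l x / scaleProd r μ x)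
        (nhdsWithin 0 (Set.Ioo 0 η)) (nhds 0))
    (M : ℕ) (hM : 1 ≤ M)
    (hhat : ℝ → ℝ) (hsm : ContDiffAt ℝ (M : ℕ∞) hhat 0)
    (δ : ℝ) (hδ : 0 < δ) (hδη : δ ≤ η)
    (hagree : ∀ x ∈ Set.Ioo (0 : ℝ) δ, hhat x = ∑ l ∈ Λ, e l * scaleProd r l x) :
    (M : ℚ) ≤ μ 0 := by
  by_contra hcon
  have hcon : μ 0 < M := not_lt.1 (fun h => hcon h.le) |>.lt_of_ne (fun h => hcon h.ge)
  have hnh : nhdsWithin (0:ℝ) (Set.Ioo 0 η) = nhdsWithin 0 (Set.Ioi 0) :=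
    nhdsWithin_Ioo_eq_nhdsGT hη
  rw [hnh] at hμo
  have hS : ∀ᶠ x in nhdsWithin (0:ℝ) (Set.Ioi 0), scaleProd r μ x ≠ 0 := by
    filter_upwards [scaleProd_eq r μ] with x hx
    rw [hx]
    exact (Real.exp_pos _).ne'
  have h1 : Tendsto (fun x => hhat x / scaleProd r μ x) (nhdsWithin 0 (Set.Ioi 0))
      (nhds (e μ)) := by
    have h : ∀ l ∈ Λ, Tendsto (fun x => e l * (scaleProd r l x / scaleProd r μ x))
        (nhdsWithin 0 (Set.Ioi 0)) (nhds (if l = μ then e μ else 0)) := by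
      intro l hl
      by_cases hlm : l = μ
      · subst hlm
        simp only [if_true]
        refine tendsto_const_nhds.congr' ?_
        filter_upwards [hS] with x hx
        rw [div_self hx, mul_one]
      · rw [if_neg hlm]
        simpa using (hμo l hl hlm).const_mul (e l)
    have h2 := tendsto_finsetSum Λ h
    simp only [Finset.sum_ite_eq', if_pos hμ] at h2
    refine h2.congr' ?_
    filter_upwards [Ioo_mem_nhdsGT hδ] with x hx
    rw [hagree x hx, Finset.sum_div]
    exact Finset.sum_congr rfl fun i _ => by ring
  obtain ⟨P, hP⟩ := exists_taylor_poly M hhat hsm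
  have hxM : Tendsto (fun x => x ^ M / scaleProd r μ x) (nhdsWithin 0 (Set.Ioi 0)) (nhds 0) := by
    have := Real.tendsto_exp_atBot.comp
      (logProd_atBot r ((Pi.single 0 (M : ℚ)) - μ) (by simpa using hcon))
    refine this.congr' ?_
    filter_upwards [pow_div_scaleProd r μ M] with x hx
    exact hx.symm
  have h2 : Tendsto (fun x => P.eval x / scaleProd r μ x) (nhdsWithin 0 (Set.Ioi 0))
      (nhds (e μ)) := by
    have := h1.sub (hP.mul hxM)
    rw [mul_zero, sub_zero] at this
    refine this.congr' ?_
    filter_upwards [hS, self_mem_nhdsWithin] with x hx hx0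
    have : x ≠ 0 := ne_of_gt hx0
    field_simp
    ring
  have hP0 : P ≠ 0 := by
    rintro rfl
    simp only [Polynomial.eval_zero, zero_div] at h2
    exact he μ hμ (tendsto_nhds_unique h2 tendsto_const_nhds)
  obtain ⟨Q, hPQ, hQ⟩ := Polynomial.exists_eq_pow_rootMultiplicity_mul_and_not_dvd P hP0 0
  set k := P.rootMultiplicity 0
  rw [Polynomial.dvd_iff_isRoot, Polynomial.IsRoot.def] at hQ
  have hQc : Tendsto (fun x => Q.eval x) (nhdsWithin 0 (Set.Ioi 0)) (nhds (Q.eval 0)) :=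
    Q.continuous.continuousAt.tendsto.mono_left nhdsWithin_le_nhds
  have h3 : Tendsto (fun x => x ^ k / scaleProd r μ x) (nhdsWithin 0 (Set.Ioi 0))
      (nhds (e μ / Q.eval 0)) := by
    refine (h2.div hQc hQ).congr' ?_
    filter_upwards [hQc.eventually_ne hQ] with x hx
    rw [hPQ]
    simp only [Pi.div_apply, map_zero, sub_zero, Polynomial.eval_mul, Polynomial.eval_pow,
      Polynomial.eval_X]
    field_simp
  have h4 : Tendsto (fun x => logProd r ((Pi.single 0 (k : ℚ)) - μ) x)
      (nhdsWithin 0 (Set.Ioi 0)) (nhds (Real.log (e μ / Q.eval 0))) := by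
    refine (h3.log (div_ne_zero (he μ hμ) hQ)).congr' ?_
    filter_upwards [pow_div_scaleProd r μ k] with x hx
    rw [hx, Real.log_exp]
  have h5 : (Pi.single 0 (k : ℚ)) - μ = 0 := by
    by_contra h0
    exact not_tendsto_nhds_of_tendsto_atTop (logProd_abs r _ h0) _ h4.abs
  have h6 : μ = Pi.single 0 (k : ℚ) := (sub_eq_zero.1 h5).symm
  refine hΛ' μ hμ ⟨⟨k, by rw [h6]; simp⟩, fun i hi => by rw [h6]; simp [hi]⟩
end
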